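/- Let T ≥ 1 be an integer. If a finite set M of real n×n matrices satisfies ρ(M) < n^{−1/(2T)}, then the set M^T of all products of T matrices from M admits a common quadratic Lyapunov function: there exists a symmetric positive definite real n×n matrix Q such that BᵀQB − Q is negative definite for every B ∈ M^T. -/

import Mathlib

open Filter Matrix

/-- The operator norm on `n × n` real matrices induced by the Euclidean norm on `ℝ^n`. -/
noncomputable def euclOpNorm {n : ℕ} (A : Matrix (Fin n) (Fin n) ℝ) : ℝ :=
  ‖LinearMap.toContinuousLinearMap (Matrix.toEuclideanLin A)‖

/-- The Euclidean norm on `ℝ^n`. -/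
noncomputable def euclNorm {n : ℕ} (x : Fin n → ℝ) : ℝ :=
  Real.sqrt (∑ i, x i ^ 2)

/-- The matrix product `A_{σ(t-1)} ⋯ A_{σ(0)}` associated to a sequence of labels `σ`. -/
noncomputable def pathProd {n N : ℕ} (A : Fin N → Matrix (Fin n) (Fin n) ℝ)
    (t : ℕ) (σ : Fin t → Fin N) : Matrix (Fin n) (Fin n) ℝ :=
  (List.ofFn fun i => A (σ i)).reverse.prod

/-- `v, σ` describe a path of length `t` in the labeled graph with edge set `E`:
its `i`-th edge goes from node `v i` to node `v (i+1)` and carries the label `σ i`. -/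
def IsPath {V : Type*} {N : ℕ} (E : Set (V × V × Fin N)) {t : ℕ}
    (v : Fin (t + 1) → V) (σ : Fin t → Fin N) : Prop :=
  ∀ i : Fin t, (v i.castSucc, v i.succ, σ i) ∈ E

/-- The labeled graph with edge set `E` is strongly connected: any node can be joined to
any node by a path of length at least 1. -/
def StronglyConnected {V : Type*} {N : ℕ} (E : Set (V × V × Fin N)) : Prop :=
  ∀ u w : V, ∃ (t : ℕ) (v : Fin (t + 1) → V) (σ : Fin t → Fin N),
    1 ≤ t ∧ IsPath E v σ ∧ v 0 = u ∧ v (Fin.last t) = w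

/-- The constrained joint spectral radius of the system `S(G, M)` with `G = (V, E)`, `M = A`. -/
noncomputable def cjsr {V : Type*} {n N : ℕ} (E : Set (V × V × Fin N))
    (A : Fin N → Matrix (Fin n) (Fin n) ℝ) : ℝ :=
  Filter.atTop.limsup fun t : ℕ =>
    sSup { x : ℝ | ∃ (v : Fin (t + 1) → V) (σ : Fin t → Fin N),
      IsPath E v σ ∧ x = euclOpNorm (pathProd A t σ) ^ (1 / (t : ℝ)) }

/-- The constrained joint spectral radius of the `T`-lifted system `S(G_T, M^T)`:
paths of length `k` in `G_T` are exactly paths of length `k * T` in `G`. -/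
noncomputable def cjsrLift {V : Type*} {n N : ℕ} (E : Set (V × V × Fin N))
    (A : Fin N → Matrix (Fin n) (Fin n) ℝ) (T : ℕ) : ℝ :=
  Filter.atTop.limsup fun k : ℕ =>
    sSup { x : ℝ | ∃ (v : Fin (k * T + 1) → V) (σ : Fin (k * T) → Fin N),
      IsPath E v σ ∧ x = euclOpNorm (pathProd A (k * T) σ) ^ (1 / (k : ℝ)) }

/-- Stability of the constrained switching system: along every infinite path of the graph,
every trajectory converges to `0`. -/
def Stable {V : Type*} {n N : ℕ} (E : Set (V × V × Fin N))
    (A : Fin N → Matrix (Fin n) (Fin n) ℝ) : Prop :=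
  ∀ (v : ℕ → V) (σ : ℕ → Fin N), (∀ t : ℕ, (v t, v (t + 1), σ t) ∈ E) →
    ∀ x0 : Fin n → ℝ,
      Tendsto (fun t : ℕ => (pathProd A t fun i : Fin t => σ i).mulVec x0)
        atTop (nhds 0)

/-- `ν` is a family of norms on `ℝ^n` indexed by the nodes. -/
def IsNormFamily {V : Type*} {n : ℕ} (ν : V → (Fin n → ℝ) → ℝ) : Prop :=
  ∀ u : V,
    (∀ x y : Fin n → ℝ, ν u (x + y) ≤ ν u x + ν u y) ∧
    (∀ (a : ℝ) (x : Fin n → ℝ), ν u (a • x) = |a| * ν u x) ∧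
    (∀ x : Fin n → ℝ, ν u x = 0 → x = 0)

/-- `ν` is a `γ`-multinorm for the system `S(G, M)`. -/
def IsMultinorm {V : Type*} {n N : ℕ} (E : Set (V × V × Fin N))
    (A : Fin N → Matrix (Fin n) (Fin n) ℝ) (γ : ℝ)
    (ν : V → (Fin n → ℝ) → ℝ) : Prop :=
  IsNormFamily ν ∧
    ∀ vi vj : V, ∀ σ : Fin N, (vi, vj, σ) ∈ E →
      ∀ x : Fin n → ℝ, ν vj ((A σ).mulVec x) ≤ γ * ν vi x

/-- `Q` is a quadratic `γ`-multinorm for the system `S(G, M)`. -/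
def IsQuadMultinorm {V : Type*} {n N : ℕ} (E : Set (V × V × Fin N))
    (A : Fin N → Matrix (Fin n) (Fin n) ℝ) (γ : ℝ)
    (Q : V → Matrix (Fin n) (Fin n) ℝ) : Prop :=
  (∀ u : V, (Q u).PosDef) ∧
    ∀ vi vj : V, ∀ σ : Fin N, (vi, vj, σ) ∈ E →
      (γ ^ 2 • Q vi - (A σ)ᵀ * Q vj * A σ).PosSemidef

/-- `Q` is a quadratic `γ`-multinorm for the lifted system `S(G_T, M^T)`: the Loewner
inequality holds along every path of length `T` of `G` (i.e. every edge of `G_T`). -/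
def IsQuadMultinormLift {V : Type*} {n N : ℕ} (E : Set (V × V × Fin N))
    (A : Fin N → Matrix (Fin n) (Fin n) ℝ) (T : ℕ) (γ : ℝ)
    (Q : V → Matrix (Fin n) (Fin n) ℝ) : Prop :=
  (∀ u : V, (Q u).PosDef) ∧
    ∀ (v : Fin (T + 1) → V) (σ : Fin T → Fin N), IsPath E v σ →
      (γ ^ 2 • Q (v 0) -
        (pathProd A T σ)ᵀ * Q (v (Fin.last T)) * pathProd A T σ).PosSemidef

/-- `Q` is a path-dependent Lyapunov function with memory `T` for `S(G, M)`:
one positive definite quadratic form per path of length `T`, with a strict decrease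
condition along every path of length `T + 1`. -/
def IsPathDepLyap {V : Type*} {n N : ℕ} (E : Set (V × V × Fin N))
    (A : Fin N → Matrix (Fin n) (Fin n) ℝ) (T : ℕ)
    (Q : (Fin (T + 1) → V) → (Fin T → Fin N) → Matrix (Fin n) (Fin n) ℝ) : Prop :=
  (∀ (v : Fin (T + 1) → V) (σ : Fin T → Fin N), IsPath E v σ → (Q v σ).PosDef) ∧
    ∀ (v : Fin (T + 2) → V) (σ : Fin (T + 1) → Fin N), IsPath E v σ →
      (Q (fun i : Fin (T + 1) => v i.castSucc) (fun i : Fin T => σ i.castSucc) -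
        (A (σ (Fin.last T)))ᵀ *
          Q (fun i : Fin (T + 1) => v i.succ) (fun i : Fin T => σ i.succ) *
            A (σ (Fin.last T))).PosDef

/-- The joint spectral radius of a finite set of matrices (arbitrary switching). -/
noncomputable def jsr {n N : ℕ} (A : Fin N → Matrix (Fin n) (Fin n) ℝ) : ℝ :=
  Filter.atTop.limsup fun t : ℕ =>
    sSup { x : ℝ | ∃ σ : Fin t → Fin N,
      x = euclOpNorm (pathProd A t σ) ^ (1 / (t : ℝ)) }

/-- The joint spectral radius of the set `M^T` of all products of `T` matrices from `M`:
products of `k` matrices from `M^T` are exactly products of `k * T` matrices from `M`. -/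
noncomputable def jsrPow {n N : ℕ} (A : Fin N → Matrix (Fin n) (Fin n) ℝ) (T : ℕ) : ℝ :=
  Filter.atTop.limsup fun k : ℕ =>
    sSup { x : ℝ | ∃ σ : Fin (k * T) → Fin N,
      x = euclOpNorm (pathProd A (k * T) σ) ^ (1 / (k : ℝ)) }

/-- The optimal value `γ*(G, M)` of the semidefinite program of Corollary 4.6. -/
noncomputable def gammaStar {V : Type*} {n N : ℕ} (E : Set (V × V × Fin N))
    (A : Fin N → Matrix (Fin n) (Fin n) ℝ) : ℝ :=
  sInf {γ : ℝ | 0 < γ ∧ ∃ Q : V → Matrix (Fin n) (Fin n) ℝ,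
    (∀ u : V, (Q u).PosDef) ∧ ∀ vi vj : V, ∀ σ : Fin N, (vi, vj, σ) ∈ E →
      (γ ^ 2 • Q vi - (A σ)ᵀ * Q vj * A σ).PosDef}

/-- The optimal value `γ*(G_T, M^T)` of the semidefinite program applied to the lifted
system `S(G_T, M^T)`. -/
noncomputable def gammaStarLift {V : Type*} {n N : ℕ} (E : Set (V × V × Fin N))
    (A : Fin N → Matrix (Fin n) (Fin n) ℝ) (T : ℕ) : ℝ :=
  sInf {γ : ℝ | 0 < γ ∧ ∃ Q : V → Matrix (Fin n) (Fin n) ℝ,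
    (∀ u : V, (Q u).PosDef) ∧
      ∀ (v : Fin (T + 1) → V) (σ : Fin T → Fin N), IsPath E v σ →
        (γ ^ 2 • Q (v 0) -
          (pathProd A T σ)ᵀ * Q (v (Fin.last T)) * pathProd A T σ).PosDef}

/-- Cauchy-Schwarz inequality for a positive definite matrix. -/
lemma aux_cs {n : ℕ} (M : Matrix (Fin n) (Fin n) ℝ) (hM : M.PosDef) (x y : Fin n → ℝ) :
    (x ⬝ᵥ y) ^ 2 ≤ (x ⬝ᵥ (M⁻¹ *ᵥ x)) * (y ⬝ᵥ (M *ᵥ y)) := by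
  have hdet : IsUnit M.det := hM.det_pos.ne'.isUnit
  set z := M⁻¹ *ᵥ x with hz
  have hMz : M *ᵥ z = x := by
    rw [hz, Matrix.mulVec_mulVec, Matrix.mul_nonsing_inv _ hdet, Matrix.one_mulVec]
  have hsym : z ⬝ᵥ (M *ᵥ y) = x ⬝ᵥ y := by
    have hT : Mᵀ = M := by simpa using hM.isHermitian.eq
    rw [Matrix.dotProduct_mulVec, ← Matrix.mulVec_transpose, hT, hMz]
  have key : ∀ s : ℝ, 0 ≤ (y ⬝ᵥ (M *ᵥ y)) * (s * s) + (-2 * (x ⬝ᵥ y)) * s + x ⬝ᵥ z := by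
    intro s
    have h := hM.posSemidef.dotProduct_mulVec_nonneg (z - s • y)
    simp only [star_trivial, Matrix.mulVec_sub, Matrix.mulVec_smul, dotProduct_sub,
      sub_dotProduct, smul_dotProduct, dotProduct_smul, hMz, hsym, smul_eq_mul] at h
    rw [dotProduct_comm z x, dotProduct_comm y x] at h
    linarith
  have := discrim_le_zero key
  unfold discrim at this
  nlinarith

/-- First-order optimality for the determinant (Kiefer-Wolfowitz). -/
lemma aux_opt {n : ℕ} (hn : 1 ≤ n) (M : Matrix (Fin n) (Fin n) ℝ) (hM : M.PosDef) (x : Fin n → ℝ)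
    (h : ∀ t : ℝ, 0 ≤ t → t ≤ 1 → ((1 - t) • M + t • vecMulVec x x).det ≤ M.det) :
    x ⬝ᵥ (M⁻¹ *ᵥ x) ≤ n := by
  have hdet : IsUnit M.det := hM.det_pos.ne'.isUnit
  by_contra! hlt
  set a := x ⬝ᵥ (M⁻¹ *ᵥ x) with ha
  have hn1 : (1 : ℝ) ≤ n := by exact_mod_cast hn
  have hform : ∀ t : ℝ, 0 ≤ t → t < 1 → ((1 - t) • M + t • vecMulVec x x).det =
      M.det * ((1 - t) ^ (n - 1) * (1 - t + t * a)) := by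
    intro t h0 h1
    have h1t : (1 - t) ≠ 0 := by linarith
    have e : (1 - t) • M + t • vecMulVec x x =
        (1 - t) • (M * (1 + M⁻¹ * ((t / (1 - t)) • vecMulVec x x))) := by
      rw [Matrix.mul_add, ← Matrix.mul_assoc, Matrix.mul_nonsing_inv _ hdet, Matrix.one_mul,
        Matrix.mul_one, smul_add, smul_smul, mul_div_cancel₀ _ h1t]
    have e2 : M⁻¹ * ((t / (1 - t)) • vecMulVec x x) =
        replicateCol Unit ((t / (1 - t)) • (M⁻¹ *ᵥ x)) * replicateRow Unit x := by
      rw [← Matrix.vecMulVec_eq, Matrix.mul_smul, Matrix.mul_vecMulVec, Matrix.smul_vecMulVec]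
    rw [e, Matrix.det_smul, Matrix.det_mul, e2, Matrix.det_one_add_replicateCol_mul_replicateRow,
      dotProduct_smul, ← ha, Fintype.card_fin, smul_eq_mul]
    obtain ⟨m, rfl⟩ : ∃ m, n = m + 1 := ⟨n - 1, by omega⟩
    rw [Nat.add_sub_cancel, pow_succ]
    field_simp
  -- choose t
  have ha1 : 0 < a - n := by linarith
  set d : ℝ := 2 * ((n : ℝ) * a + (a - n)) with hd
  have hdpos : 0 < d := by
    have : 0 < (n : ℝ) * a := mul_pos (by linarith) (by linarith)
    linarith
  set t := (a - n) / d with ht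
  have htpos : 0 < t := by positivity
  have htd : t * d = a - n := by rw [ht]; field_simp
  have ht1 : t < 1 := by
    rw [ht, div_lt_one hdpos]
    nlinarith
  have h1 := h t htpos.le ht1.le
  rw [hform t htpos.le ht1] at h1
  have hb : 1 + ((n - 1 : ℕ) : ℝ) * (-t) ≤ (1 + (-t)) ^ (n - 1) :=
    one_add_mul_le_pow (by linarith) _
  rw [Nat.cast_sub hn, Nat.cast_one] at hb
  have hpos : 0 < 1 - t + t * a := by nlinarith
  have h2 : 1 < (1 - t) ^ (n - 1) * (1 - t + t * a) := by
    calc (1 : ℝ) < (1 + ((n : ℝ) - 1) * (-t)) * (1 - t + t * a) := by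
          have : (1 + ((n : ℝ) - 1) * (-t)) * (1 - t + t * a) - 1 =
            t * ((a - n) - t * ((n - 1) * (a - 1))) := by ring
          have h3 : ((n : ℝ) - 1) * (a - 1) < d := by nlinarith
          have h4 : t * (((n : ℝ) - 1) * (a - 1)) < t * d := by gcongr
          have h5 : 0 < t * ((a - n) - t * ((n - 1) * (a - 1))) := by
            apply mul_pos htpos; linarith
          linarith
      _ ≤ (1 - t) ^ (n - 1) * (1 - t + t * a) := by
          apply mul_le_mul_of_nonneg_right _ hpos.le
          simpa [sub_eq_add_neg] using hb
  nlinarith [hM.det_pos]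

/-- The John-type core argument. -/
lemma aux_core {n : ℕ} (hn : 1 ≤ n) (K : Set (Fin n → ℝ)) (R : ℝ)
    (hR : ∀ x ∈ K, ∀ i, |x i| ≤ R) (hK : ∀ i, Pi.single i (1 : ℝ) ∈ K)
    (g : ℝ) (hg : 0 < g) (hgn : g ^ 2 * n < 1) :
    ∃ Q : Matrix (Fin n) (Fin n) ℝ, Q.PosDef ∧
      ∀ B : Matrix (Fin n) (Fin n) ℝ, (∀ x ∈ K, g⁻¹ • (x ᵥ* B) ∈ K) →
        (Q - Bᵀ * Q * B).PosDef := by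
  classical
  have hn0 : (0 : ℝ) < n := by exact_mod_cast hn
  set S : Set (Matrix (Fin n) (Fin n) ℝ) := (fun x => vecMulVec x x) '' K with hS
  set C := closure (convexHull ℝ S) with hC
  have hCmin : ∀ D : Set (Matrix (Fin n) (Fin n) ℝ), IsClosed D → Convex ℝ D → S ⊆ D → C ⊆ D :=
    fun D h1 h2 h3 => closure_minimal (convexHull_min h3 h2) h1
  have hSC : S ⊆ C := (subset_convexHull ℝ S).trans subset_closure
  have hCconv : Convex ℝ C := (convex_convexHull ℝ S).closure
  have hquad : ∀ x y : Fin n → ℝ, y ⬝ᵥ (vecMulVec x x *ᵥ y) = (x ⬝ᵥ y) ^ 2 := by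
    intro x y
    rw [Matrix.vecMulVec_mulVec]
    simp [dotProduct_smul, dotProduct_comm y x, sq]
  have hR0 : 0 ≤ R := le_trans (abs_nonneg _) (hR _ (hK ⟨0, hn⟩) ⟨0, hn⟩)
  -- compactness
  set D0 : Set (Matrix (Fin n) (Fin n) ℝ) :=
    Set.univ.pi fun _ => Set.univ.pi fun _ => Set.Icc (-(R * R)) (R * R) with hD0
  have hD0c : IsCompact D0 :=
    isCompact_univ_pi fun _ => isCompact_univ_pi fun _ => isCompact_Icc
  have hCD0 : C ⊆ D0 := by
    apply hCmin D0
    · exact isClosed_set_pi fun _ _ => isClosed_set_pi fun _ _ => isClosed_Icc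
    · exact convex_pi fun _ _ => convex_pi fun _ _ => convex_Icc _ _
    · rintro _ ⟨x, hx, rfl⟩ i _ j _
      refine abs_le.1 (?_ : |x i * x j| ≤ R * R)
      rw [abs_mul]
      exact mul_le_mul (hR x hx i) (hR x hx j) (abs_nonneg _) hR0
  have hCc : IsCompact C := hD0c.of_isClosed_subset isClosed_closure hCD0
  have hI : ((n : ℝ)⁻¹) • (1 : Matrix (Fin n) (Fin n) ℝ) ∈ C := by
    have h1 : (∑ i : Fin n, (n : ℝ)⁻¹ •
        vecMulVec (Pi.single i (1 : ℝ)) (Pi.single i (1 : ℝ))) ∈ C := by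
      apply hCconv.sum_mem
      · intros; positivity
      · simp; field_simp
      · intro i _; exact hSC ⟨_, hK i, rfl⟩
    convert h1 using 1
    rw [← Finset.smul_sum]
    congr 1
    ext a b
    rw [Matrix.sum_apply]
    simp [vecMulVec_apply, Matrix.one_apply, Pi.single_apply]
  obtain ⟨M, hMC, hmax⟩ := hCc.exists_isMaxOn ⟨_, hI⟩
    (f := fun M : Matrix (Fin n) (Fin n) ℝ => M.det) (Continuous.matrix_det continuous_id).continuousOn
  have hdetpos : 0 < M.det := by
    refine lt_of_lt_of_le ?_ (hmax hI)
    simp only [Matrix.det_smul, Matrix.det_one]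
    positivity
  have hcq : ∀ (B : Matrix (Fin n) (Fin n) ℝ) (y : Fin n → ℝ),
      Continuous fun N : Matrix (Fin n) (Fin n) ℝ => y ⬝ᵥ ((Bᵀ * N * B) *ᵥ y) := by
    intro B y
    fun_prop
  have hcv : ∀ (B : Matrix (Fin n) (Fin n) ℝ) (y : Fin n → ℝ),
      IsLinearMap ℝ fun N : Matrix (Fin n) (Fin n) ℝ => y ⬝ᵥ ((Bᵀ * N * B) *ᵥ y) := by
    intro B y
    constructor
    · intro N N'
      simp [Matrix.mul_add, Matrix.add_mul, Matrix.add_mulVec, dotProduct_add]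
    · intro c N
      simp [Matrix.smul_mulVec, dotProduct_smul]
  have hle : ∀ (B : Matrix (Fin n) (Fin n) ℝ) (y : Fin n → ℝ) (c : ℝ),
      (∀ x ∈ K, ((x ᵥ* B) ⬝ᵥ y) ^ 2 ≤ c) → y ⬝ᵥ ((Bᵀ * M * B) *ᵥ y) ≤ c := by
    intro B y c h
    refine hCmin {N | y ⬝ᵥ ((Bᵀ * N * B) *ᵥ y) ≤ c} (isClosed_le (hcq B y) continuous_const)
      (convex_halfSpace_le (hcv B y) c) ?_ hMC
    rintro _ ⟨x, hx, rfl⟩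
    have : Bᵀ * vecMulVec x x * B = vecMulVec (x ᵥ* B) (x ᵥ* B) := by
      rw [Matrix.mul_vecMulVec, Matrix.vecMulVec_mul, Matrix.mulVec_transpose]
    simp only [Set.mem_ofPred_eq, this, hquad]
    exact h x hx
  have hsymM : Mᵀ = M := by
    refine hCmin {N | Nᵀ = N} (isClosed_eq (by fun_prop) continuous_id) ?_ ?_ hMC
    · intro a ha b hb s t _ _ _
      simp only [Set.mem_ofPred_eq] at *
      simp [ha, hb]
    · rintro _ ⟨x, hx, rfl⟩
      simp [Matrix.transpose_vecMulVec]
  have hpsd : ∀ y, 0 ≤ y ⬝ᵥ (M *ᵥ y) := by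
    intro y
    have := hCmin {N | 0 ≤ y ⬝ᵥ (((1 : Matrix (Fin n) (Fin n) ℝ)ᵀ * N * 1) *ᵥ y)}
      (isClosed_le continuous_const (hcq 1 y)) (convex_halfSpace_ge (hcv 1 y) 0) ?_ hMC
    · simpa using this
    · rintro _ ⟨x, hx, rfl⟩
      simp only [Set.mem_ofPred_eq, Matrix.transpose_one, Matrix.one_mul, Matrix.mul_one, hquad]
      positivity
  have hMpsd : M.PosSemidef :=
    Matrix.PosSemidef.of_dotProduct_mulVec_nonneg (by simpa [Matrix.IsHermitian] using hsymM)
      (by simpa using hpsd)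
  have hMpd : M.PosDef := by
    rw [hMpsd.posDef_iff_isUnit, Matrix.isUnit_iff_isUnit_det]
    exact hdetpos.ne'.isUnit
  have hopt : ∀ x ∈ K, x ⬝ᵥ (M⁻¹ *ᵥ x) ≤ n := by
    intro x hx
    refine aux_opt hn M hMpd x fun t h0 h1 => hmax ?_
    exact hCconv hMC (hSC ⟨x, hx, rfl⟩) (by linarith) h0 (by ring)
  refine ⟨M, hMpd, fun B hB => ?_⟩
  refine Matrix.PosDef.of_dotProduct_mulVec_pos ?_ ?_
  · have : (M - Bᵀ * M * B)ᵀ = M - Bᵀ * M * B := by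
      simp [Matrix.transpose_mul, hsymM, Matrix.mul_assoc]
    simpa [Matrix.IsHermitian] using this
  · intro y hy
    have hy' := hMpd.dotProduct_mulVec_pos hy
    simp only [star_trivial] at hy' ⊢
    rw [Matrix.sub_mulVec, dotProduct_sub]
    have := hle B y (g ^ 2 * (n * (y ⬝ᵥ (M *ᵥ y)))) ?_
    · nlinarith
    · intro x hx
      have h1 := aux_cs M hMpd (g⁻¹ • (x ᵥ* B)) y
      have h2 := hopt _ (hB x hx)
      have h3 : ((g⁻¹ • (x ᵥ* B)) ⬝ᵥ y) ^ 2 ≤ n * (y ⬝ᵥ (M *ᵥ y)) :=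
        h1.trans (mul_le_mul_of_nonneg_right h2 hy'.le)
      rw [smul_dotProduct, smul_eq_mul] at h3
      calc ((x ᵥ* B) ⬝ᵥ y) ^ 2 = g ^ 2 * (g⁻¹ * ((x ᵥ* B) ⬝ᵥ y)) ^ 2 := by field_simp
        _ ≤ _ := by gcongr

lemma aux_append {n N : ℕ} (A : Fin N → Matrix (Fin n) (Fin n) ℝ) (s t : ℕ)
    (σ : Fin s → Fin N) (τ : Fin t → Fin N) :
    pathProd A t τ * pathProd A s σ = pathProd A (s + t) (Fin.append σ τ) := by
  unfold pathProd
  have : (fun i => A (Fin.append σ τ i)) = Fin.append (fun i => A (σ i)) (fun i => A (τ i)) := by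
    funext i
    refine Fin.addCases (fun j => ?_) (fun j => ?_) i <;> simp
  rw [this, List.ofFn_fin_append, List.reverse_append, List.prod_append]

lemma aux_opNorm_mul {n : ℕ} (P Q : Matrix (Fin n) (Fin n) ℝ) :
    euclOpNorm (P * Q) ≤ euclOpNorm P * euclOpNorm Q := by
  unfold euclOpNorm
  have : LinearMap.toContinuousLinearMap (Matrix.toEuclideanLin (P * Q)) =
      (LinearMap.toContinuousLinearMap (Matrix.toEuclideanLin P)).comp
      (LinearMap.toContinuousLinearMap (Matrix.toEuclideanLin Q)) := by
    ext x i
    simp [Matrix.toEuclideanLin, Matrix.toLpLin_apply, Matrix.mulVec_mulVec]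
  rw [this]
  exact ContinuousLinearMap.opNorm_comp_le _ _

lemma aux_opNorm_one {n : ℕ} : euclOpNorm (1 : Matrix (Fin n) (Fin n) ℝ) ≤ 1 := by
  unfold euclOpNorm
  refine ContinuousLinearMap.opNorm_le_bound _ zero_le_one fun x => ?_
  simp [Matrix.toEuclideanLin]

lemma aux_opNorm_nonneg {n : ℕ} (P : Matrix (Fin n) (Fin n) ℝ) : 0 ≤ euclOpNorm P :=
  norm_nonneg _

lemma aux_entry {n : ℕ} (P : Matrix (Fin n) (Fin n) ℝ) (i j : Fin n) :
    |P i j| ≤ euclOpNorm P := by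
  have h := (LinearMap.toContinuousLinearMap (Matrix.toEuclideanLin P)).le_opNorm
    (EuclideanSpace.single j (1 : ℝ))
  rw [EuclideanSpace.norm_single, norm_one, mul_one] at h
  refine le_trans ?_ h
  have h2 := PiLp.norm_apply_le ((LinearMap.toContinuousLinearMap (Matrix.toEuclideanLin P))
    (EuclideanSpace.single j (1 : ℝ))) i
  refine le_trans (le_of_eq ?_) h2
  simp [Matrix.toEuclideanLin, Matrix.toLpLin_apply]

lemma aux_crude {n N : ℕ} (A : Fin N → Matrix (Fin n) (Fin n) ℝ) (L : ℝ)
    (hL : ∀ i, euclOpNorm (A i) ≤ L) (hL0 : 0 ≤ L) (t : ℕ) (σ : Fin t → Fin N) :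
    euclOpNorm (pathProd A t σ) ≤ L ^ t := by
  induction t with
  | zero => simpa [pathProd] using aux_opNorm_one
  | succ t ih =>
    have : pathProd A (t + 1) σ = pathProd A t (fun i => σ i.succ) * A (σ 0) := by
      simp [pathProd, List.ofFn_succ]
    rw [this, pow_succ]
    exact (aux_opNorm_mul _ _).trans
      (mul_le_mul (ih _) (hL _) (aux_opNorm_nonneg _) (by positivity))

lemma aux_growth {n N : ℕ} (hN : 1 ≤ N) (A : Fin N → Matrix (Fin n) (Fin n) ℝ) (δ : ℝ)
    (hδ : 0 < δ) (h : jsr A < δ) :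
    ∃ R : ℝ, ∀ (t : ℕ) (σ : Fin t → Fin N), euclOpNorm (pathProd A t σ) ≤ R * δ ^ t := by
  obtain ⟨L, hLδ, hL⟩ : ∃ L : ℝ, δ ≤ L ∧ ∀ i, euclOpNorm (A i) ≤ L := by
    obtain ⟨L, hL⟩ := (Set.finite_range fun i => euclOpNorm (A i)).bddAbove
    exact ⟨max L δ, le_max_right _ _, fun i => (hL ⟨i, rfl⟩).trans (le_max_left _ _)⟩
  have hL0 : 0 < L := hδ.trans_le hLδ
  have hcr := aux_crude A L hL hL0.le
  have hel : ∀ (t : ℕ), 1 ≤ t → ∀ σ : Fin t → Fin N,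
      euclOpNorm (pathProd A t σ) ^ (1 / (t : ℝ)) ≤ L := by
    intro t ht σ
    calc euclOpNorm (pathProd A t σ) ^ (1 / (t : ℝ)) ≤ (L ^ t) ^ (1 / (t : ℝ)) :=
          Real.rpow_le_rpow (aux_opNorm_nonneg _) (hcr t σ) (by positivity)
      _ = L := by
          rw [one_div]; exact Real.pow_rpow_inv_natCast hL0.le (by omega)
  have hbdd : Filter.IsBoundedUnder (· ≤ ·) atTop (fun t : ℕ =>
      sSup { x : ℝ | ∃ σ : Fin t → Fin N, x = euclOpNorm (pathProd A t σ) ^ (1 / (t : ℝ)) }) := by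
    refine Filter.isBoundedUnder_of_eventually_le (a := L) ?_
    filter_upwards [eventually_ge_atTop 1] with t ht
    refine Real.sSup_le ?_ hL0.le
    rintro _ ⟨σ, rfl⟩
    exact hel t ht σ
  have hev := Filter.eventually_lt_of_limsup_lt h hbdd
  obtain ⟨t0, ht0⟩ := Filter.eventually_atTop.1 hev
  have hq : 1 ≤ L / δ := (one_le_div hδ).2 hLδ
  refine ⟨(L / δ) ^ (t0 + 1), fun t σ => ?_⟩
  by_cases htt : t0 + 1 ≤ t
  · have h1 := ht0 t (by omega)
    have h2 : euclOpNorm (pathProd A t σ) ^ (1 / (t : ℝ)) ≤ δ := by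
      refine lt_of_le_of_lt (le_csSup ?_ ?_) h1 |>.le
      on_goal 2 => exact ⟨σ, rfl⟩
      refine ⟨L, ?_⟩
      rintro _ ⟨σ, rfl⟩
      exact hel t (by omega) σ
    have h3 : euclOpNorm (pathProd A t σ) ≤ δ ^ t := by
      have h4 := pow_le_pow_left₀ (Real.rpow_nonneg (aux_opNorm_nonneg _) _) h2 t
      rwa [one_div, Real.rpow_inv_natCast_pow (aux_opNorm_nonneg _) (by omega)] at h4
    refine h3.trans ?_
    have := one_le_pow₀ hq (n := t0 + 1)
    have h5 : 0 < δ ^ t := by positivity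
    nlinarith
  · refine (hcr t σ).trans ?_
    calc L ^ t = (L / δ) ^ t * δ ^ t := by rw [← mul_pow]; congr 1; field_simp
      _ ≤ _ := by
        gcongr ?_ * _
        exact pow_le_pow_right₀ hq (by omega)

/-- if `ρ(M) < n^{-1/(2T)}` then `M^T` admits a common quadratic Lyapunov
function. -/
theorem ando_shih_products {n N : ℕ} (hn : 1 ≤ n) (hN : 1 ≤ N)
    (A : Fin N → Matrix (Fin n) (Fin n) ℝ)
    (T : ℕ) (hT : 1 ≤ T)
    (hρ : jsr A < (n : ℝ) ^ (-1 / (2 * (T : ℝ)))) :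
    ∃ Q : Matrix (Fin n) (Fin n) ℝ, Q.PosDef ∧
      ∀ σ : Fin T → Fin N,
        (Q - (pathProd A T σ)ᵀ * Q * pathProd A T σ).PosDef := by
  have hn0 : (0 : ℝ) < n := by exact_mod_cast hn
  have hT0 : (0 : ℝ) < T := by exact_mod_cast hT
  have hr0 : 0 < (n : ℝ) ^ (-1 / (2 * (T : ℝ))) := Real.rpow_pos_of_pos hn0 _
  obtain ⟨δ, hδ1, hδ2⟩ := exists_between (max_lt hρ hr0)
  have hδ : 0 < δ := (le_max_right _ _).trans_lt hδ1
  obtain ⟨R, hR⟩ := aux_growth hN A δ hδ ((le_max_left _ _).trans_lt hδ1)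
  have hgn : (δ ^ T) ^ 2 * n < 1 := by
    have h1 : δ ^ (T * 2) < ((n : ℝ) ^ (-1 / (2 * (T : ℝ)))) ^ (T * 2) :=
      pow_lt_pow_left₀ hδ2 hδ.le (by omega)
    have h2 : ((n : ℝ) ^ (-1 / (2 * (T : ℝ)))) ^ (T * 2) = (n : ℝ)⁻¹ := by
      rw [← Real.rpow_natCast, ← Real.rpow_mul hn0.le, ← Real.rpow_neg_one]
      congr 1
      push_cast
      field_simp
    rw [h2, pow_mul] at h1
    calc (δ ^ T) ^ 2 * n < (n : ℝ)⁻¹ * n := by gcongr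
      _ = 1 := by field_simp
  obtain ⟨Q, hQ, hQ2⟩ := aux_core hn
    {x | ∃ (t : ℕ) (σ : Fin t → Fin N) (i : Fin n), x = (δ ^ t)⁻¹ • (pathProd A t σ) i} R
    (by
      rintro _ ⟨t, σ, i, rfl⟩ j
      have h1 := (aux_entry (pathProd A t σ) i j).trans (hR t σ)
      have h5 : 0 < δ ^ t := by positivity
      rw [Pi.smul_apply, smul_eq_mul, abs_mul, abs_of_pos (inv_pos.2 h5), inv_mul_le_iff₀ h5]
      linarith)
    (by
      intro i
      refine ⟨0, Fin.elim0, i, ?_⟩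
      ext j
      simp [pathProd, Matrix.one_apply, Pi.single_apply, eq_comm])
    (δ ^ T) (by positivity) hgn
  refine ⟨Q, hQ, fun σ => hQ2 _ ?_⟩
  rintro _ ⟨t, τ, i, rfl⟩
  refine ⟨T + t, Fin.append σ τ, i, ?_⟩
  rw [← aux_append, Matrix.mul_apply_eq_vecMul, Matrix.smul_vecMul, smul_smul, pow_add, mul_inv]
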